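/- Let 1 < p ≤ 2 and let X = ℓ_p be the real sequence space with norm ‖x‖_p = (Σ_{i=1}^∞ |x_i|^p)^{1/p}. Let E ⊆ ℓ_p be a nonempty bounded set and let G be a multiresolution family for E with inflation factor A ≥ 240. If Σ_{Q ∈ G} β_E(Q)^p·diam Q < ∞, then E is contained in some rectifiable curve Γ ⊆ ℓ_p. -/

import Mathlib

open Metric MeasureTheory Set Bornology
open scoped ENNReal NNReal Classical

universe u

noncomputable section

/-- The affine line through `a` with direction `v`. -/
def lineThrough {X : Type u} [AddCommGroup X] [Module ℝ X] (a v : X) : Set X :=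
  {y | ∃ t : ℝ, y = a + t • v}

/-- The Jones beta number of `E` in the window `Q`. -/
def jonesBeta {X : Type u} [NormedAddCommGroup X] [NormedSpace ℝ X] (E Q : Set X) : ℝ :=
  if E ∩ Q = ∅ then 0
  else sInf {r : ℝ | ∃ a v : X, v ≠ 0 ∧
    r = sSup ((fun x => infDist x (lineThrough a v) / Metric.diam Q) '' (E ∩ Q))}

/-- `net` encodes a partial multiresolution family for `E`. -/
def IsPartialMultiresolution {X : Type u} [NormedAddCommGroup X]
    (E : Set X) (net : ℤ → Set X) : Prop :=
  (∀ k, net k ⊆ E) ∧ (∀ k, net k ⊆ net (k + 1)) ∧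
    (∀ k : ℤ, ∀ x ∈ net k, ∀ y ∈ net k, x ≠ y → (2 : ℝ) ^ (-k) ≤ dist x y)

/-- `net` encodes a multiresolution family for `E`. -/
def IsMultiresolution {X : Type u} [NormedAddCommGroup X]
    (E : Set X) (net : ℤ → Set X) : Prop :=
  IsPartialMultiresolution E net ∧ ∀ k : ℤ, ∀ e ∈ E, ∃ x ∈ net k, dist e x ≤ (2 : ℝ) ^ (-k)

/-- The sum `Σ_{Q ∈ G} β_E(Q)^p · diam Q`. -/
def betaSum {X : Type u} [NormedAddCommGroup X] [NormedSpace ℝ X]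
    (E : Set X) (net : ℤ → Set X) (A p : ℝ) : ℝ≥0∞ :=
  ∑' (k : ℤ), ∑' (x : net k),
    ENNReal.ofReal (jonesBeta E (closedBall (x : X) (A * (2 : ℝ) ^ (-k))) ^ p *
      Metric.diam (closedBall (x : X) (A * (2 : ℝ) ^ (-k))))

/-- `S_{E,p}(G) = diam E + Σ_{Q ∈ G} β_E(Q)^p · diam Q`. -/
def SEp {X : Type u} [NormedAddCommGroup X] [NormedSpace ℝ X]
    (E : Set X) (net : ℤ → Set X) (A p : ℝ) : ℝ≥0∞ :=
  ENNReal.ofReal (Metric.diam E) + betaSum E net A p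

/-- `Γ` is a rectifiable curve. -/
def IsRectifiableCurve {X : Type u} [NormedAddCommGroup X]
    [MeasurableSpace X] [BorelSpace X] (Γ : Set X) : Prop :=
  (∃ f : ℝ → X, ContinuousOn f (Set.Icc (0 : ℝ) 1) ∧ Γ = f '' Set.Icc (0 : ℝ) 1) ∧
    μH[1] Γ < ⊤

/-- The sequence space `ℓ_p` over `ℝ`. -/
abbrev ellp (p : ℝ) : Type := ↥(lp (fun _ : ℕ => ℝ) (ENNReal.ofReal p))

section Combinatorics

/-- Any two points of `X` are joined through edges of `N` and edges of `P`. -/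
def Linked {V : Type*} (X : Finset V) (N : V → Finset V) (P : Finset (V × V)) : Prop :=
  ∀ x ∈ X, ∀ y ∈ X, Relation.EqvGen (fun a b => b ∈ N a ∨ (a, b) ∈ P) x y

lemma eqvGen_of_forall {α : Type*} {R S : α → α → Prop}
    (h : ∀ a b, R a b → Relation.EqvGen S a b) {a b : α} (hab : Relation.EqvGen R a b) :
    Relation.EqvGen S a b := by
  induction hab with
  | rel a b hab => exact h a b hab
  | refl a => exact .refl a
  | symm a b _ ih => exact ih.symm
  | trans a b c _ _ ih ih' => exact ih.trans _ _ _ ih'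

lemma linked_insert {V : Type*} {X : Finset V} {N N' : V → Finset V}
    {P P' : Finset (V × V)} {z p : V}
    (h : Linked X N P) (hp : p ∈ X)
    (hN : ∀ a b, b ∈ N a ∨ (a, b) ∈ P → Relation.EqvGen (fun a b => b ∈ N' a ∨ (a, b) ∈ P') a b)
    (hz : Relation.EqvGen (fun a b => b ∈ N' a ∨ (a, b) ∈ P') p z) :
    Linked (insert z X) N' P' := by
  have key : ∀ x ∈ insert z X, Relation.EqvGen (fun a b => b ∈ N' a ∨ (a, b) ∈ P') p x := by
    intro x hx
    rcases Finset.mem_insert.1 hx with rfl | hx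
    · exact hz
    · exact eqvGen_of_forall hN (h p hp x hx)
  intro x hx y hy
  exact .trans _ p _ (key x hx).symm (key y hy)

variable {V : Type*} [PseudoMetricSpace V]

/-- Seen from `x`, the points `u` and `v` lie in opposite directions. -/
def OppositeAt (x u v : V) : Prop := dist x u < dist u v ∧ dist x v < dist u v

/-- `φ` is, up to an additive error `e`, an isometry of the `r / 2`-separated set `S` into the
line. -/
structure IsCoordinate (S : Set V) (φ : V → ℝ) (r e : ℝ) : Prop where
  separated : ∀ a ∈ S, ∀ b ∈ S, a ≠ b → r / 2 ≤ dist a b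
  le_dist : ∀ a ∈ S, ∀ b ∈ S, |φ a - φ b| ≤ dist a b
  dist_le : ∀ a ∈ S, ∀ b ∈ S, a ≠ b → dist a b ≤ |φ a - φ b| + e

namespace IsCoordinate

variable {S : Set V} {φ : V → ℝ} {r e : ℝ}

lemma neg (h : IsCoordinate S φ r e) : IsCoordinate S (fun x => -φ x) r e where
  separated := h.separated
  le_dist a ha b hb := by
    have := h.le_dist a ha b hb
    rwa [show -φ a - -φ b = -(φ a - φ b) by ring, abs_neg]
  dist_le a ha b hb hab := by
    have := h.dist_le a ha b hb hab
    rwa [show -φ a - -φ b = -(φ a - φ b) by ring, abs_neg]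

lemma dist_le_of_lt (h : IsCoordinate S φ r e) {a b : V} (ha : a ∈ S) (hb : b ∈ S)
    (hab : φ a < φ b) : dist a b ≤ φ b - φ a + e := by
  have := h.dist_le a ha b hb (by rintro rfl; exact lt_irrefl _ hab)
  rwa [abs_of_neg (by linarith), neg_sub] at this

lemma sub_le_dist (h : IsCoordinate S φ r e) {a b : V} (ha : a ∈ S) (hb : b ∈ S) :
    φ b - φ a ≤ dist a b := by
  have := h.le_dist a ha b hb
  have := neg_abs_le (φ a - φ b)
  linarith

lemma lt_or_lt (h : IsCoordinate S φ r e) (hr : 0 < r) (he : e ≤ r / 16) {a b : V} (ha : a ∈ S)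
    (hb : b ∈ S) (hab : a ≠ b) : φ a < φ b ∨ φ b < φ a := by
  have h1 := h.separated a ha b hb hab
  have h2 := h.dist_le a ha b hb hab
  apply lt_or_gt_of_ne
  intro h3
  rw [h3, sub_self, abs_zero] at h2
  linarith

lemma opposite_of_lt (h : IsCoordinate S φ r e) (he : e ≤ r / 16) {a b c : V}
    (ha : a ∈ S) (hb : b ∈ S) (hc : c ∈ S) (hab : φ a < φ b) (hbc : φ b < φ c) :
    OppositeAt b a c := by
  have h1 := h.dist_le_of_lt ha hb hab
  have h2 := h.dist_le_of_lt hb hc hbc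
  have h3 := h.sub_le_dist ha hc
  have h4 := h.separated a ha b hb (by rintro rfl; exact lt_irrefl _ hab)
  have h5 := h.separated b hb c hc (by rintro rfl; exact lt_irrefl _ hbc)
  constructor
  · rw [dist_comm b a]; linarith
  · linarith

lemma not_opposite_of_lt_of_le (h : IsCoordinate S φ r e) (he : e ≤ r / 16)
    {a b c : V} (ha : a ∈ S) (hb : b ∈ S) (hc : c ∈ S) (hba : φ b < φ a) (hac : φ a ≤ φ c) :
    ¬ OppositeAt b a c := by
  rintro ⟨h1, h2⟩
  have hne : a ≠ c := by
    rintro rfl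
    rw [dist_self] at h1
    exact absurd h1 (not_lt.2 dist_nonneg)
  have h3 := h.dist_le a ha c hc hne
  rw [abs_of_nonpos (by linarith)] at h3
  have h4 := h.dist_le_of_lt hb ha hba
  have h5 := h.sub_le_dist hb hc
  have h6 := h.separated b hb a ha (by rintro rfl; exact lt_irrefl _ hba)
  linarith

lemma not_opposite_of_lt_of_lt (h : IsCoordinate S φ r e) (he : e ≤ r / 16)
    {a b c : V} (ha : a ∈ S) (hb : b ∈ S) (hc : c ∈ S) (hba : φ b < φ a) (hbc : φ b < φ c) :
    ¬ OppositeAt b a c := by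
  rcases le_total (φ a) (φ c) with hac | hca
  · exact h.not_opposite_of_lt_of_le he ha hb hc hba hac
  · intro ho
    refine h.not_opposite_of_lt_of_le he hc hb ha hbc hca ?_
    rw [OppositeAt, dist_comm c a]
    exact ho.symm

end IsCoordinate

/-- `N` is the neighbour function of a graph on `X` with edges of length at most `T`, in which
every vertex has at most two neighbours, lying in opposite directions. -/
structure IsPathGraph (X : Finset V) (N : V → Finset V) (T : ℝ) : Prop where
  mem : ∀ x, ∀ y ∈ N x, y ∈ X
  symm : ∀ x, ∀ y ∈ N x, x ∈ N y
  irrefl : ∀ x, x ∉ N x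
  card_le : ∀ x, (N x).card ≤ 2
  opposite : ∀ x, ∀ u ∈ N x, ∀ v ∈ N x, u ≠ v → OppositeAt x u v
  dist_le : ∀ x, ∀ y ∈ N x, dist x y ≤ T

lemma IsPathGraph.eq_empty {X : Finset V} {N : V → Finset V} {T : ℝ} (h : IsPathGraph X N T)
    {z : V} (hz : z ∉ X) : N z = ∅ := by
  rw [Finset.eq_empty_iff_forall_notMem]
  intro y hy
  exact hz (h.mem _ _ (h.symm _ _ hy))

/-- Half the length of the edges at `x`, plus a toll `C x` for each missing neighbour. -/
def vertexCost (N : V → Finset V) (C : V → ℝ) (x : V) : ℝ :=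
  (2 - (N x).card) * C x + (∑ y ∈ N x, dist x y) / 2

/-- `X` is the vertex set of a connected graph which consists of a path graph with edges of length
at most `T` and of further edges, with total cost at most `B`. -/
def Connectable (X : Finset V) (T : ℝ) (C : V → ℝ) (B : ℝ) : Prop :=
  ∃ (N : V → Finset V) (P : Finset (V × V)), IsPathGraph X N T ∧ Linked X N P ∧
    (∀ e ∈ P, e.1 ∈ X ∧ e.2 ∈ X) ∧
    ∑ x ∈ X, vertexCost N C x + (∑ e ∈ P, dist e.1 e.2) / 8 ≤ B

lemma Connectable.insert_isolated {X : Finset V} {T : ℝ} {C : V → ℝ} {B : ℝ} {z p : V}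
    (h : Connectable X T C B) (hz : z ∉ X) (hp : p ∈ X) :
    Connectable (insert z X) T C (B + (2 * C z + dist p z / 8)) := by
  obtain ⟨N, P, hN, hl, hP, hB⟩ := h
  refine ⟨N, insert (p, z) P, ⟨fun x y hy => Finset.mem_insert_of_mem (hN.mem x y hy), hN.symm,
    hN.irrefl, hN.card_le, hN.opposite, hN.dist_le⟩, ?_, ?_, ?_⟩
  · refine linked_insert hl hp (fun a b hab => .rel _ _ ?_) (.rel _ _ ?_)
    · exact hab.imp_right Finset.mem_insert_of_mem
    · exact .inr (Finset.mem_insert_self _ _)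
  · intro e he
    rcases Finset.mem_insert.1 he with rfl | he
    · exact ⟨Finset.mem_insert_of_mem hp, Finset.mem_insert_self _ _⟩
    · exact (hP e he).imp Finset.mem_insert_of_mem Finset.mem_insert_of_mem
  · have hnot : (p, z) ∉ P := fun hh => hz (hP _ hh).2
    rw [Finset.sum_insert hz, Finset.sum_insert hnot, vertexCost, hN.eq_empty hz]
    simp only [Finset.card_empty, Nat.cast_zero, Finset.sum_empty]
    linarith

lemma Connectable.mono_toll {X : Finset V} {T : ℝ} {C C' : V → ℝ} {B : ℝ}
    (h : Connectable X T C B) (hC : ∀ x ∈ X, C' x ≤ C x) : Connectable X T C' B := by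
  obtain ⟨N, P, hN, hl, hP, hB⟩ := h
  refine ⟨N, P, hN, hl, hP, le_trans ?_ hB⟩
  gcongr with x hx
  unfold vertexCost
  have h2 : ((N x).card : ℝ) ≤ 2 := by exact_mod_cast hN.card_le x
  have := hC x hx
  gcongr

lemma Connectable.mono {X : Finset V} {T : ℝ} {C : V → ℝ} {B B' : ℝ}
    (h : Connectable X T C B) (hB : B ≤ B') : Connectable X T C B' := by
  obtain ⟨N, P, hN, hl, hP, hB'⟩ := h
  exact ⟨N, P, hN, hl, hP, hB'.trans hB⟩

lemma Connectable.prune {X : Finset V} {T T' κ B : ℝ} (h : Connectable X T (fun _ => κ) B)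
    (hκ : 8 * κ ≤ 3 * T') : Connectable X T' (fun _ => κ) B := by
  obtain ⟨N, P, hN, hl, hP, hB⟩ := h
  set L : V → Finset V := fun x => (N x).filter (fun y => ¬ dist x y ≤ T') with hL
  set Q : Finset (V × V) := (X.sigma L).map (Equiv.sigmaEquivProd V V).toEmbedding with hQ
  refine ⟨fun x => (N x).filter (fun y => dist x y ≤ T'), P ∪ Q, ⟨?_, ?_, ?_, ?_, ?_, ?_⟩,
    ?_, ?_, ?_⟩
  · intro x y hy
    exact hN.mem x y (Finset.mem_filter.1 hy).1
  · intro x y hy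
    rw [Finset.mem_filter] at hy ⊢
    exact ⟨hN.symm x y hy.1, by rw [dist_comm]; exact hy.2⟩
  · intro x hx
    exact hN.irrefl x (Finset.mem_filter.1 hx).1
  · intro x
    exact (Finset.card_filter_le _ _).trans (hN.card_le x)
  · intro x u hu v hv
    exact hN.opposite x u (Finset.mem_filter.1 hu).1 v (Finset.mem_filter.1 hv).1
  · intro x y hy
    exact (Finset.mem_filter.1 hy).2
  · intro x hx y hy
    refine eqvGen_of_forall (fun a b hab => .rel _ _ ?_) (hl x hx y hy)
    rcases hab with hab | hab
    · by_cases hd : dist a b ≤ T'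
      · exact .inl (Finset.mem_filter.2 ⟨hab, hd⟩)
      · refine .inr (Finset.mem_union_right _ ?_)
        rw [hQ, Finset.mem_map]
        exact ⟨⟨a, b⟩, Finset.mem_sigma.2 ⟨hN.mem _ _ (hN.symm _ _ hab),
          Finset.mem_filter.2 ⟨hab, hd⟩⟩, rfl⟩
    · exact .inr (Finset.mem_union_left _ hab)
  · intro e he
    rcases Finset.mem_union.1 he with he | he
    · exact hP e he
    · rw [hQ, Finset.mem_map] at he
      obtain ⟨⟨a, b⟩, hab, rfl⟩ := he
      rw [Finset.mem_sigma] at hab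
      exact ⟨hab.1, hN.mem _ _ (Finset.mem_filter.1 hab.2).1⟩
  · have hsum : ∑ e ∈ P ∪ Q, dist e.1 e.2 ≤
        ∑ e ∈ P, dist e.1 e.2 + ∑ x ∈ X, ∑ y ∈ L x, dist x y := by
      have h1 : ∑ e ∈ Q, dist e.1 e.2 = ∑ x ∈ X, ∑ y ∈ L x, dist x y := by
        rw [hQ, Finset.sum_map, Finset.sum_sigma]
        rfl
      rw [← h1, ← Finset.sum_union_inter]
      have : 0 ≤ ∑ e ∈ P ∩ Q, dist e.1 e.2 := Finset.sum_nonneg fun _ _ => dist_nonneg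
      linarith
    have hv : ∀ x ∈ X, vertexCost (fun x => (N x).filter (fun y => dist x y ≤ T')) (fun _ => κ) x
        + (∑ y ∈ L x, dist x y) / 8 ≤ vertexCost N (fun _ => κ) x := by
      intro x _
      unfold vertexCost
      have hc : (N x).card = ((N x).filter (fun y => dist x y ≤ T')).card + (L x).card :=
        (Finset.card_filter_add_card_filter_not _).symm
      have hs : ∑ y ∈ N x, dist x y =
          ∑ y ∈ (N x).filter (fun y => dist x y ≤ T'), dist x y + ∑ y ∈ L x, dist x y :=
        (Finset.sum_filter_add_sum_filter_not _ _ _).symm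
      have hlow : (L x).card * T' ≤ ∑ y ∈ L x, dist x y := by
        rw [← nsmul_eq_mul]
        exact Finset.card_nsmul_le_sum _ _ _ fun y hy => (not_le.1 (Finset.mem_filter.1 hy).2).le
      have hk : (L x).card * (8 * κ) ≤ (L x).card * (3 * T') := by gcongr
      rw [hs, hc]
      push_cast
      linarith
    have := Finset.sum_le_sum hv
    rw [Finset.sum_add_distrib, ← Finset.sum_div] at this
    linarith

end Combinatorics

section Insertion

variable {V : Type*} [PseudoMetricSpace V]

lemma OppositeAt.swap {x u v : V} (h : OppositeAt x u v) : OppositeAt x v u := by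
  rw [OppositeAt, dist_comm v u]
  exact And.symm h

/-- The graph `N` with the pendant vertex `z` attached to `x`. -/
def insertEnd (N : V → Finset V) (x z : V) : V → Finset V :=
  Function.update (Function.update N x (insert z (N x))) z {x}

/-- The graph `N` with the edge from `x` to `v` subdivided by the vertex `z`. -/
def insertBetween (N : V → Finset V) (x v z : V) : V → Finset V :=
  Function.update (Function.update (Function.update N x (insert z ((N x).erase v)))
    v (insert z ((N v).erase x))) z {x, v}

variable {X : Finset V} {N : V → Finset V} {T : ℝ} {z x v : V}

lemma mem_insertEnd (h : IsPathGraph X N T) (hz : z ∉ X) (hx : x ∈ X) {a b : V} :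
    b ∈ insertEnd N x z a ↔ b ∈ N a ∨ (a = z ∧ b = x) ∨ (a = x ∧ b = z) := by
  have h1 := h.eq_empty hz
  have hzx : x ≠ z := by rintro rfl; exact hz hx
  unfold insertEnd
  simp only [Function.update_apply]
  split_ifs with h2 h3
  · subst h2; simp [h1, hzx.symm]
  · subst h3; simp [h2, or_comm]
  · simp [h2, h3]

lemma mem_insertBetween (h : IsPathGraph X N T) (hz : z ∉ X) (hx : x ∈ X) (hv : v ∈ N x) {a b : V} :
    b ∈ insertBetween N x v z a ↔ (b ∈ N a ∧ ¬ (a = x ∧ b = v) ∧ ¬ (a = v ∧ b = x)) ∨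
      (a = z ∧ (b = x ∨ b = v)) ∨ ((a = x ∨ a = v) ∧ b = z) := by
  have h1 := h.eq_empty hz
  have hzx : x ≠ z := by rintro rfl; exact hz hx
  have hzv : v ≠ z := by rintro rfl; exact hz (h.mem _ _ hv)
  have hxv : x ≠ v := by rintro rfl; exact h.irrefl _ hv
  unfold insertBetween
  simp only [Function.update_apply]
  split_ifs with h2 h3 h4
  · subst h2; simp [h1, hzx.symm, hzv.symm]
  · subst h3; simp [h2, hxv.symm]; tauto
  · subst h4; simp [h2, h3]; tauto
  · simp [h2, h3, h4]

lemma IsPathGraph.insertEnd (h : IsPathGraph X N T) (hz : z ∉ X) (hx : x ∈ X)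
    (hcard : (N x).card ≤ 1) (hopp : ∀ u ∈ N x, OppositeAt x u z) (hT : dist x z ≤ T) :
    IsPathGraph (insert z X) (insertEnd N x z) T := by
  have hzx : x ≠ z := by rintro rfl; exact hz hx
  have hNz := h.eq_empty hz
  refine ⟨?_, ?_, ?_, ?_, ?_, ?_⟩
  · intro a b hb
    rw [mem_insertEnd h hz hx] at hb
    rw [Finset.mem_insert]
    rcases hb with hb | ⟨-, rfl⟩ | ⟨-, rfl⟩
    · exact .inr (h.mem _ _ hb)
    · exact .inr hx
    · exact .inl rfl
  · intro a b hb
    rw [mem_insertEnd h hz hx] at hb ⊢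
    rcases hb with hb | hb | hb
    · exact .inl (h.symm _ _ hb)
    · exact .inr (.inr hb.symm)
    · exact .inr (.inl hb.symm)
  · intro a ha
    rw [mem_insertEnd h hz hx] at ha
    rcases ha with ha | ⟨rfl, rfl⟩ | ⟨rfl, rfl⟩
    · exact h.irrefl _ ha
    · exact hzx rfl
    · exact hzx rfl
  · intro a
    unfold _root_.insertEnd
    simp only [Function.update_apply]
    split_ifs with h2 h3
    · simp
    · exact (Finset.card_insert_le _ _).trans (by omega)
    · exact h.card_le a
  · intro a u hu w hw huw
    rw [mem_insertEnd h hz hx] at hu hw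
    rcases hu with hu | ⟨rfl, rfl⟩ | ⟨rfl, rfl⟩
    · rcases hw with hw | ⟨rfl, rfl⟩ | ⟨rfl, rfl⟩
      · exact h.opposite _ _ hu _ hw huw
      · simp [hNz] at hu
      · exact hopp _ hu
    · rcases hw with hw | ⟨-, rfl⟩ | ⟨rfl, rfl⟩
      · simp [hNz] at hw
      · exact absurd rfl huw
      · exact absurd rfl huw
    · rcases hw with hw | ⟨rfl, rfl⟩ | ⟨-, rfl⟩
      · exact (hopp _ hw).swap
      · exact absurd rfl huw
      · exact absurd rfl huw
  · intro a b hb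
    rw [mem_insertEnd h hz hx] at hb
    rcases hb with hb | ⟨rfl, rfl⟩ | ⟨rfl, rfl⟩
    · exact h.dist_le _ _ hb
    · rwa [dist_comm]
    · exact hT

lemma IsPathGraph.insertBetween (h : IsPathGraph X N T) (hz : z ∉ X) (hx : x ∈ X) (hv : v ∈ N x)
    (hoppx : ∀ u ∈ N x, u ≠ v → OppositeAt x u z) (hoppv : ∀ u ∈ N v, u ≠ x → OppositeAt v u z)
    (hoppz : OppositeAt z x v) (hTx : dist x z ≤ T) (hTv : dist v z ≤ T) :
    IsPathGraph (insert z X) (insertBetween N x v z) T := by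
  have hzx : x ≠ z := by rintro rfl; exact hz hx
  have hzv : v ≠ z := by rintro rfl; exact hz (h.mem _ _ hv)
  have hxv : x ≠ v := by rintro rfl; exact h.irrefl _ hv
  have hNz := h.eq_empty hz
  refine ⟨?_, ?_, ?_, ?_, ?_, ?_⟩
  · intro a b hb
    rw [mem_insertBetween h hz hx hv] at hb
    rw [Finset.mem_insert]
    rcases hb with hb | ⟨-, rfl | rfl⟩ | ⟨-, rfl⟩
    · exact .inr (h.mem _ _ hb.1)
    · exact .inr hx
    · exact .inr (h.mem _ _ hv)
    · exact .inl rfl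
  · intro a b hb
    rw [mem_insertBetween h hz hx hv] at hb ⊢
    have := h.symm a b
    tauto
  · intro a ha
    rw [mem_insertBetween h hz hx hv] at ha
    have := h.irrefl a
    grind
  · intro a
    unfold _root_.insertBetween
    simp only [Function.update_apply]
    split_ifs with h2 h3 h4
    · exact Finset.card_le_two
    · refine (Finset.card_insert_le _ _).trans ?_
      rw [Finset.card_erase_of_mem (h.symm _ _ hv)]
      have := h.card_le v
      omega
    · refine (Finset.card_insert_le _ _).trans ?_
      rw [Finset.card_erase_of_mem hv]
      have := h.card_le x
      omega
    · exact h.card_le a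
  · intro a u hu w hw huw
    rw [mem_insertBetween h hz hx hv] at hu hw
    have h1 := h.opposite a u
    have h2 := fun hu => h1 hu w
    by_cases haz : a = z
    · subst haz
      simp only [hNz, hzx.symm, hzv.symm, Finset.notMem_empty] at hu hw
      simp only [false_and, true_and, false_or, or_false] at hu hw
      rcases hu with rfl | rfl <;> rcases hw with rfl | rfl
      · exact absurd rfl huw
      · exact hoppz
      · exact hoppz.swap
      · exact absurd rfl huw
    · by_cases hax : a = x
      · subst hax
        simp only [hxv, haz, false_and, true_and, false_or, true_or, not_false_eq_true,
          and_true] at hu hw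
        rcases hu with ⟨hu, hu'⟩ | rfl <;> rcases hw with ⟨hw, hw'⟩ | rfl
        · exact h2 hu hw huw
        · exact hoppx _ hu hu'
        · exact (hoppx _ hw hw').swap
        · exact absurd rfl huw
      · by_cases hav : a = v
        · subst hav
          simp only [hxv.symm, haz, false_and, true_and, false_or, or_true,
            not_false_eq_true] at hu hw
          rcases hu with ⟨hu, hu'⟩ | rfl <;> rcases hw with ⟨hw, hw'⟩ | rfl
          · exact h2 hu hw huw
          · exact hoppv _ hu hu'
          · exact (hoppv _ hw hw').swap
          · exact absurd rfl huw
        · simp only [hax, haz, hav, false_and, or_false, not_false_eq_true, and_true] at hu hw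
          exact h2 hu hw huw
  · intro a b hb
    rw [mem_insertBetween h hz hx hv] at hb
    rcases hb with hb | ⟨rfl, rfl | rfl⟩ | ⟨rfl | rfl, rfl⟩
    · exact h.dist_le _ _ hb.1
    · rwa [dist_comm]
    · rwa [dist_comm]
    · exact hTx
    · exact hTv

lemma sum_vertexCost_insertEnd (h : IsPathGraph X N T) (hz : z ∉ X) (hx : x ∈ X) (C : V → ℝ) :
    ∑ a ∈ insert z X, vertexCost (insertEnd N x z) C a =
      ∑ a ∈ X, vertexCost N C a + (C z - C x + dist x z) := by
  have hzx : x ≠ z := by rintro rfl; exact hz hx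
  have hzN : ∀ a, z ∉ N a := fun a ha => hz (h.mem _ _ ha)
  rw [Finset.sum_insert hz, ← Finset.add_sum_erase _ _ hx, ← Finset.add_sum_erase _ _ hx]
  have h1 : ∑ a ∈ X.erase x, vertexCost (insertEnd N x z) C a =
      ∑ a ∈ X.erase x, vertexCost N C a := by
    refine Finset.sum_congr rfl fun a ha => ?_
    rw [Finset.mem_erase] at ha
    have haz : a ≠ z := by rintro rfl; exact hz ha.2
    simp [vertexCost, insertEnd, Function.update_of_ne haz, Function.update_of_ne ha.1]
  have h2 : vertexCost (insertEnd N x z) C z = C z + dist x z / 2 := by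
    simp only [vertexCost, insertEnd, Function.update_self, Finset.card_singleton,
      Finset.sum_singleton, dist_comm z x]
    norm_num
  have h3 : vertexCost (insertEnd N x z) C x = vertexCost N C x - C x + dist x z / 2 := by
    simp only [vertexCost, insertEnd, Function.update_of_ne hzx, Function.update_self,
      Finset.card_insert_of_notMem (hzN x), Finset.sum_insert (hzN x)]
    push_cast
    ring
  rw [h1, h2, h3]
  ring

lemma sum_vertexCost_insertBetween (h : IsPathGraph X N T) (hz : z ∉ X) (hx : x ∈ X)
    (hv : v ∈ N x) (C : V → ℝ) :
    ∑ a ∈ insert z X, vertexCost (insertBetween N x v z) C a =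
      ∑ a ∈ X, vertexCost N C a + (dist x z + dist z v - dist x v) := by
  have hzx : x ≠ z := by rintro rfl; exact hz hx
  have hvX := h.mem _ _ hv
  have hzv : v ≠ z := by rintro rfl; exact hz hvX
  have hxv : x ≠ v := by rintro rfl; exact h.irrefl _ hv
  have hzN : ∀ a, z ∉ N a := fun a ha => hz (h.mem _ _ ha)
  have hvX' : v ∈ X.erase x := Finset.mem_erase.2 ⟨hxv.symm, hvX⟩
  rw [Finset.sum_insert hz, ← Finset.add_sum_erase _ _ hx, ← Finset.add_sum_erase _ _ hvX',
    ← Finset.add_sum_erase _ _ hx, ← Finset.add_sum_erase _ _ hvX']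
  have h1 : ∑ a ∈ (X.erase x).erase v, vertexCost (insertBetween N x v z) C a =
      ∑ a ∈ (X.erase x).erase v, vertexCost N C a := by
    refine Finset.sum_congr rfl fun a ha => ?_
    rw [Finset.mem_erase, Finset.mem_erase] at ha
    have haz : a ≠ z := by rintro rfl; exact hz ha.2.2
    simp [vertexCost, insertBetween, Function.update_of_ne haz, Function.update_of_ne ha.1,
      Function.update_of_ne ha.2.1]
  have h2 : vertexCost (insertBetween N x v z) C z = (dist x z + dist z v) / 2 := by
    simp only [vertexCost, insertBetween, Function.update_self, Finset.card_pair hxv,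
      Finset.sum_pair hxv, dist_comm z x]
    norm_num
  have key : ∀ a b, b ∈ N a → vertexCost (fun _ => insert z ((N a).erase b)) C a =
      vertexCost N C a + (dist a z - dist a b) / 2 := by
    intro a b hb
    have hn : z ∉ (N a).erase b := fun hh => hzN a (Finset.mem_of_mem_erase hh)
    simp only [vertexCost, Finset.card_insert_of_notMem hn, Finset.sum_insert hn,
      Finset.card_erase_add_one hb, ← Finset.add_sum_erase _ _ hb]
    ring
  have h3 : vertexCost (insertBetween N x v z) C x =
      vertexCost (fun _ => insert z ((N x).erase v)) C x := by
    simp only [vertexCost, insertBetween, Function.update_of_ne hzx, Function.update_of_ne hxv,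
      Function.update_self]
  have h4 : vertexCost (insertBetween N x v z) C v =
      vertexCost (fun _ => insert z ((N v).erase x)) C v := by
    simp only [vertexCost, insertBetween, Function.update_of_ne hzv, Function.update_self]
  rw [h1, h2, h3, h4, key x v hv, key v x (h.symm _ _ hv), dist_comm v x, dist_comm v z]
  ring

lemma Connectable.insert_of_isCoordinate_of_lt {C φ : V → ℝ} {B r e : ℝ} {p : V}
    (h : Connectable X (8 * r) C B) (hz : z ∉ X) (hp : p ∈ X) (hzp : dist z p ≤ r)
    (hφ : IsCoordinate (insert z ↑X ∩ closedBall z (20 * r)) φ r e) (hr : 0 < r) (he0 : 0 ≤ e)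
    (he : e ≤ r / 16)
    (hC : ∀ x, C z ≤ C x + dist x p - dist z p) (hlt : φ p < φ z) :
    Connectable (insert z X) (8 * r) C (B + 2 * e) := by
  obtain ⟨N, P, hN, hl, hP, hB⟩ := h
  set S := insert z (X : Set V) ∩ closedBall z (20 * r) with hS
  have hzS : z ∈ S := ⟨mem_insert _ _, mem_closedBall_self (by positivity)⟩
  have hXS : ∀ a ∈ X, dist a z ≤ 20 * r → a ∈ S := fun a ha hd => ⟨mem_insert_of_mem _ ha, hd⟩
  have hpS : p ∈ S := hXS p hp (by rw [dist_comm]; linarith)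
  obtain ⟨x, hx, hmax⟩ := Finset.exists_max_image (X.filter fun a => a ∈ S ∧ φ a < φ z) φ
    ⟨p, Finset.mem_filter.2 ⟨hp, hpS, hlt⟩⟩
  rw [Finset.mem_filter] at hx
  obtain ⟨hxX, hxS, hxz⟩ := hx
  have hpx : φ p ≤ φ x := hmax p (Finset.mem_filter.2 ⟨hp, hpS, hlt⟩)
  have hne : ∀ a ∈ X, a ≠ z := by rintro a ha rfl; exact hz ha
  have hright : ∀ a ∈ X, a ∈ S → φ x < φ a → φ z < φ a := by
    intro a ha haS hxa
    rcases hφ.lt_or_lt hr he haS hzS (hne a ha) with h1 | h1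
    · exact absurd (hmax a (Finset.mem_filter.2 ⟨ha, haS, h1⟩)) (not_le.2 hxa)
    · exact h1
  have hdxz := hφ.dist_le_of_lt hxS hzS hxz
  have hpz := hφ.sub_le_dist hpS hzS
  rw [dist_comm] at hpz
  have hxz2 : dist x z ≤ r + e := by linarith
  have hCx : C z ≤ C x - dist x z + 2 * e := by
    have h1 := hC x
    have h2 : dist x p ≤ φ x - φ p + e := by
      by_cases hxp : x = p
      · subst hxp; rw [dist_self]; linarith
      · have := hφ.dist_le x hxS p hpS hxp
        rwa [abs_of_nonneg (by linarith)] at this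
    linarith
  have hnbr : ∀ u ∈ N x, u ∈ S := by
    intro u hu
    refine hXS u (hN.mem _ _ hu) ?_
    have h1 := hN.dist_le _ _ hu
    have h2 := dist_triangle u x z
    rw [dist_comm u x] at h2
    linarith
  have hneq : ∀ a, ∀ u ∈ N a, a ≠ u := by rintro a u hu rfl; exact hN.irrefl _ hu
  by_cases hex : ∃ v ∈ N x, φ x < φ v
  · obtain ⟨v, hv, hxv⟩ := hex
    have hvX := hN.mem _ _ hv
    have hvS := hnbr v hv
    have hzv := hright v hvX hvS hxv
    have hdvz := hφ.dist_le_of_lt hzS hvS hzv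
    have hdxv := hφ.sub_le_dist hxS hvS
    have hdxv' := hN.dist_le _ _ hv
    have hsep := hφ.separated x hxS z hzS (hne x hxX)
    refine ⟨insertBetween N x v z, P, hN.insertBetween hz hxX hv ?_ ?_ ?_ (by linarith) ?_,
      ?_, ?_, ?_⟩
    · intro u hu huv
      have huS := hnbr u hu
      refine hφ.opposite_of_lt he huS hxS hzS ?_ hxz
      rcases hφ.lt_or_lt hr he huS hxS (hneq _ _ hu).symm with h1 | h1
      · exact h1
      · exact absurd (hN.opposite x u hu v hv huv)
          (hφ.not_opposite_of_lt_of_lt he huS hxS hvS h1 hxv)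
    · intro u hu hux
      have huS : u ∈ S := by
        refine hXS u (hN.mem _ _ hu) ?_
        have h1 := hN.dist_le _ _ hu
        have h2 := dist_triangle u v z
        rw [dist_comm u v, dist_comm v z] at h2
        linarith
      refine (hφ.opposite_of_lt he hzS hvS huS hzv ?_).swap
      rcases hφ.lt_or_lt hr he huS hvS (hneq _ _ hu).symm with h1 | h1
      · refine absurd (hN.opposite v u hu x (hN.symm _ _ hv) hux) ?_
        refine hφ.neg.not_opposite_of_lt_of_lt he huS hvS hxS ?_ ?_
        · exact neg_lt_neg h1
        · exact neg_lt_neg hxv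
      · exact h1
    · exact hφ.opposite_of_lt he hxS hzS hvS hxz hzv
    · rw [dist_comm]; linarith
    · have hmem := @mem_insertBetween _ _ X N (8 * r) z x v hN hz hxX hv
      have hxz' : Relation.EqvGen (fun a b => b ∈ insertBetween N x v z a ∨ (a, b) ∈ P) x z :=
        .rel _ _ (.inl (by rw [hmem]; simp))
      have hvz' : Relation.EqvGen (fun a b => b ∈ insertBetween N x v z a ∨ (a, b) ∈ P) v z :=
        .rel _ _ (.inl (by rw [hmem]; simp))
      refine linked_insert hl hxX (fun a b hab => ?_) hxz'
      rcases hab with hab | hab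
      · by_cases h1 : a = x ∧ b = v
        · obtain ⟨rfl, rfl⟩ := h1
          exact hxz'.trans _ _ _ hvz'.symm
        · by_cases h2 : a = v ∧ b = x
          · obtain ⟨rfl, rfl⟩ := h2
            exact hvz'.trans _ _ _ hxz'.symm
          · exact .rel _ _ (.inl (hmem.2 (.inl ⟨hab, h1, h2⟩)))
      · exact .rel _ _ (.inr hab)
    · exact fun e he => (hP e he).imp Finset.mem_insert_of_mem Finset.mem_insert_of_mem
    · rw [sum_vertexCost_insertBetween hN hz hxX hv]
      linarith
  · push Not at hex
    have hleft : ∀ u ∈ N x, φ u < φ x := by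
      intro u hu
      rcases hφ.lt_or_lt hr he (hnbr u hu) hxS (hneq _ _ hu).symm with h1 | h1
      · exact h1
      · exact absurd h1 (not_lt.2 (hex u hu))
    refine ⟨insertEnd N x z, P, hN.insertEnd hz hxX ?_ ?_ (by linarith), ?_, ?_, ?_⟩
    · rw [Finset.card_le_one]
      intro u hu w hw
      by_contra huw
      refine absurd (hN.opposite x u hu w hw huw) ?_
      refine hφ.neg.not_opposite_of_lt_of_lt he (hnbr u hu) hxS (hnbr w hw) ?_ ?_
      · exact neg_lt_neg (hleft u hu)
      · exact neg_lt_neg (hleft w hw)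
    · intro u hu
      exact hφ.opposite_of_lt he (hnbr u hu) hxS hzS (hleft u hu) hxz
    · have hmem := @mem_insertEnd _ _ X N (8 * r) z x hN hz hxX
      refine linked_insert hl hxX (fun a b hab => .rel _ _ ?_) (.rel _ _ (.inl ?_))
      · exact hab.imp_left fun h1 => hmem.2 (.inl h1)
      · rw [hmem]; simp
    · exact fun e he => (hP e he).imp Finset.mem_insert_of_mem Finset.mem_insert_of_mem
    · rw [sum_vertexCost_insertEnd hN hz hxX]
      linarith

lemma Connectable.insert_of_isCoordinate {C φ : V → ℝ} {B r e : ℝ} {p : V}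
    (h : Connectable X (8 * r) C B) (hz : z ∉ X) (hp : p ∈ X) (hzp : dist z p ≤ r)
    (hφ : IsCoordinate (insert z ↑X ∩ closedBall z (20 * r)) φ r e) (hr : 0 < r) (he0 : 0 ≤ e)
    (he : e ≤ r / 16) (hC : ∀ x, C z ≤ C x + dist x p - dist z p) :
    Connectable (insert z X) (8 * r) C (B + 2 * e) := by
  have hne : p ≠ z := by rintro rfl; exact hz hp
  have hpS : p ∈ closedBall z (20 * r) := by
    rw [mem_closedBall, dist_comm]
    linarith
  rcases hφ.lt_or_lt hr he ⟨mem_insert_of_mem _ hp, hpS⟩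
    ⟨mem_insert _ _, mem_closedBall_self (by positivity)⟩ hne with h1 | h1
  · exact h.insert_of_isCoordinate_of_lt hz hp hzp hφ hr he0 he hC h1
  · exact h.insert_of_isCoordinate_of_lt hz hp hzp hφ.neg hr he0 he hC (neg_lt_neg h1)

end Insertion

section Flatness

variable {V : Type u} [NormedAddCommGroup V] [NormedSpace ℝ V]

/-- Clarkson's inequality for the exponent `p`. -/
def HasClarkson (V : Type u) [NormedAddCommGroup V] (p : ℝ) : Prop :=
  ∀ x y : V, ‖x + y‖ ^ p + ‖x - y‖ ^ p ≤ 2 * (‖x‖ ^ p + ‖y‖ ^ p)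

lemma jonesBeta_nonneg (E Q : Set V) : 0 ≤ jonesBeta E Q := by
  unfold jonesBeta
  split_ifs
  · exact le_rfl
  · refine Real.sInf_nonneg ?_
    rintro _ ⟨a, v, -, rfl⟩
    refine Real.sSup_nonneg ?_
    rintro _ ⟨x, -, rfl⟩
    exact div_nonneg infDist_nonneg diam_nonneg

lemma exists_line_of_jonesBeta_lt [Nontrivial V] {E Q : Set V} (hQ : IsBounded Q)
    (hd : 0 < diam Q) {b : ℝ} (hb : jonesBeta E Q < b) :
    ∃ a v : V, v ≠ 0 ∧ ∀ x ∈ E ∩ Q, ∃ t : ℝ, ‖x - (a + t • v)‖ < b * diam Q := by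
  obtain ⟨v₀, hv₀⟩ := exists_ne (0 : V)
  unfold jonesBeta at hb
  split_ifs at hb with hE
  · exact ⟨0, v₀, hv₀, by simp [hE]⟩
  · obtain ⟨_, ⟨a, v, hv, rfl⟩, hlt⟩ := exists_lt_of_csInf_lt (by exact ⟨_, 0, v₀, hv₀, rfl⟩) hb
    refine ⟨a, v, hv, fun x hx => ?_⟩
    have ha : a ∈ lineThrough a v := ⟨0, by simp⟩
    have hbdd : BddAbove ((fun x => infDist x (lineThrough a v) / diam Q) '' (E ∩ Q)) := by
      obtain ⟨R, hR⟩ := hQ.subset_closedBall a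
      refine ⟨R / diam Q, ?_⟩
      rintro _ ⟨y, hy, rfl⟩
      have := (infDist_le_dist_of_mem (x := y) ha).trans (mem_closedBall.1 (hR hy.2))
      dsimp only
      gcongr
    have h1 : infDist x (lineThrough a v) / diam Q < b :=
      (le_csSup hbdd ⟨x, hx, rfl⟩).trans_lt hlt
    rw [div_lt_iff₀ hd, infDist_lt_iff ⟨a, ha⟩] at h1
    obtain ⟨_, ⟨t, rfl⟩, h2⟩ := h1
    exact ⟨t, by rwa [← dist_eq_norm]⟩

lemma HasClarkson.norm_add_rpow_le {p : ℝ} (hp : 1 < p) (h : HasClarkson V p)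
    {φ : StrongDual ℝ V} (hφ : ‖φ‖ = 1) {x w : V} (hx : φ x = ‖x‖) (hw : φ w = 0) :
    ‖x + w‖ ^ p ≤ |φ (x + w)| ^ p + 2 * ‖w‖ ^ p := by
  have h1 := h x w
  have h2 : ‖x‖ ≤ ‖x - w‖ := by
    have h3 := φ.le_opNorm (x - w)
    rw [hφ, one_mul, map_sub, hx, hw, sub_zero, norm_norm] at h3
    exact h3
  have h3 : ‖x‖ ^ p ≤ ‖x - w‖ ^ p := by gcongr
  rw [map_add, hx, hw, add_zero, abs_norm]
  linarith

lemma sub_le_of_rpow_le {p s d r c : ℝ} (hp : 1 < p) (hs : 0 ≤ s) (hsd : s ≤ d) (hr : 0 < r)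
    (hrd : r ≤ d) (h : d ^ p ≤ s ^ p + c) : d - s ≤ c / r ^ (p - 1) := by
  have hd : 0 < d := hr.trans_le hrd
  have h1 : s ^ p ≤ s * d ^ (p - 1) := by
    rcases hs.eq_or_lt with rfl | hs'
    · rw [Real.zero_rpow (by linarith), zero_mul]
    · calc s ^ p = s * s ^ (p - 1) := by
            rw [Real.rpow_sub_one hs'.ne']
            field_simp
        _ ≤ s * d ^ (p - 1) := by gcongr
  have h2 : d ^ p = d * d ^ (p - 1) := by
    rw [Real.rpow_sub_one hd.ne']
    field_simp
  have h3 : r ^ (p - 1) ≤ d ^ (p - 1) := by gcongr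
  rw [le_div_iff₀ (by positivity)]
  calc (d - s) * r ^ (p - 1) ≤ (d - s) * d ^ (p - 1) :=
        mul_le_mul_of_nonneg_left h3 (by linarith)
    _ ≤ c := by rw [sub_mul]; linarith

/-- The constant in the comparison of distances with coordinates along a line. -/
def flatnessConst (A p : ℝ) : ℝ := 2 * (4 * A) ^ p * 2 ^ (p - 1)

lemma exists_isCoordinate [Nontrivial V] {p : ℝ} (hp : 1 < p) (hcl : HasClarkson V p) {E : Set V}
    {z : V} {A r b : ℝ} (hA : 0 < A) (hr : 0 < r)
    (hb : jonesBeta E (closedBall z (A * (r / 2))) < b) {S : Set V}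
    (hS : S ⊆ E ∩ closedBall z (A * (r / 2)))
    (hsep : ∀ x ∈ S, ∀ y ∈ S, x ≠ y → r / 2 ≤ dist x y) :
    ∃ φ : V → ℝ, IsCoordinate S φ r (flatnessConst A p * b ^ p * r) := by
  have hb0 : 0 < b := (jonesBeta_nonneg _ _).trans_lt hb
  have hdiam : diam (closedBall z (A * (r / 2))) = A * r := by
    rw [diam_closedBall_eq z (by positivity)]
    ring
  obtain ⟨a, v, hv, hline⟩ := exists_line_of_jonesBeta_lt isBounded_closedBall
    (by rw [hdiam]; positivity) hb
  rw [hdiam] at hline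
  obtain ⟨φ, hφ, hφv⟩ := exists_dual_vector ℝ v (norm_ne_zero_iff.2 hv)
  refine ⟨φ, hsep, ?_, ?_⟩
  · intro x _ y _
    have := φ.le_opNorm (x - y)
    rwa [hφ, one_mul, map_sub, Real.norm_eq_abs, ← dist_eq_norm] at this
  intro x hx y hy hxy
  obtain ⟨s, hs⟩ := hline x (hS hx)
  obtain ⟨t, ht⟩ := hline y (hS hy)
  have hvn : ‖v‖ ≠ 0 := norm_ne_zero_iff.2 hv
  set w' := (x - (a + s • v)) - (y - (a + t • v)) with hw'
  set w := w' - (φ w' / ‖v‖) • v with hw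
  have hφw : φ w = 0 := by
    rw [hw, map_sub, map_smul, hφv]
    simp [hvn]
  have hw'n : ‖w'‖ ≤ 2 * (b * (A * r)) := (norm_sub_le _ _).trans (by linarith)
  have hwn : ‖w‖ ≤ 4 * (b * (A * r)) := by
    have h1 := φ.le_opNorm w'
    rw [hφ, one_mul] at h1
    have h2 : ‖(φ w' / ‖v‖) • v‖ = ‖φ w'‖ := by
      rw [norm_smul, norm_div, norm_norm, div_mul_cancel₀ _ hvn]
    have h3 := norm_sub_le w' ((φ w' / ‖v‖) • v)
    rw [h2] at h3
    linarith
  set c := s - t + φ w' / ‖v‖ with hc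
  have hdecomp : x - y = c • v + w := by
    rw [hw, hw', hc]
    module
  have hpow : dist x y ^ p ≤ |φ x - φ y| ^ p + 2 * (4 * (b * (A * r))) ^ p := by
    have h4 : ‖w‖ ^ p ≤ (4 * (b * (A * r))) ^ p := by gcongr
    rw [dist_eq_norm, ← map_sub, hdecomp]
    rcases le_total 0 c with h0 | h0
    · have := hcl.norm_add_rpow_le hp hφ (x := c • v) (w := w)
        (by rw [map_smul, hφv, norm_smul, Real.norm_of_nonneg h0]; simp) hφw
      linarith
    · have := hcl.norm_add_rpow_le hp hφ (x := (-c) • v) (w := -w)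
        (by rw [map_smul, hφv, norm_smul, Real.norm_of_nonneg (neg_nonneg.2 h0)]; simp)
        (by rw [map_neg, hφw, neg_zero])
      rw [neg_smul, ← neg_add, norm_neg, norm_neg, map_neg, abs_neg] at this
      linarith
  have hle : |φ x - φ y| ≤ dist x y := by
    have := φ.le_opNorm (x - y)
    rwa [hφ, one_mul, map_sub, Real.norm_eq_abs, ← dist_eq_norm] at this
  have := sub_le_of_rpow_le hp (abs_nonneg _) hle (by positivity) (hsep x hx y hy hxy) hpow
  have hconst : 2 * (4 * (b * (A * r))) ^ p / (r / 2) ^ (p - 1) =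
      flatnessConst A p * b ^ p * r := by
    unfold flatnessConst
    rw [show 4 * (b * (A * r)) = (4 * A) * b * r by ring, Real.mul_rpow (by positivity) hr.le,
      Real.mul_rpow (by positivity) hb0.le, Real.div_rpow hr.le (by norm_num),
      Real.rpow_sub_one hr.ne']
    have : r ^ p ≠ 0 := by positivity
    field_simp
  rw [hconst] at this
  linarith

lemma Connectable.insert_of_jonesBeta [Nontrivial V] {p : ℝ} (hp : 1 < p) (hcl : HasClarkson V p)
    {E : Set V} {A r : ℝ} (hA : 240 ≤ A) (hr : 0 < r) {X : Finset V} {C : V → ℝ} {B : ℝ} {z q : V}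
    (h : Connectable X (8 * r) C B) (hz : z ∉ X) (hq : q ∈ X) (hzq : dist z q ≤ r)
    (hE : ∀ x ∈ insert z X, x ∈ E)
    (hsep : ∀ x ∈ insert z X, ∀ y ∈ insert z X, x ≠ y → r / 2 ≤ dist x y)
    (hCz : C z ≤ 3 * r) (hC : ∀ x, C z ≤ C x + dist x q - dist z q) {τ : ℝ} (hτ : 0 < τ) :
    Connectable (insert z X) (8 * r) C (B + 112 * flatnessConst A p *
      jonesBeta E (closedBall z (A * (r / 2))) ^ p * r + τ) := by
  set β := jonesBeta E (closedBall z (A * (r / 2))) with hβ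
  have hβ0 : 0 ≤ β := jonesBeta_nonneg _ _
  set K := flatnessConst A p with hK
  have hK0 : 0 < K := by
    rw [hK, flatnessConst]
    positivity
  rcases lt_or_ge (K * β ^ p) (1 / 16) with hgood | hbad
  · have hcont : ContinuousAt (fun b : ℝ => K * b ^ p) β :=
      (Real.continuousAt_rpow_const _ _ (.inr (by linarith))).const_mul K
    have h1 : ∀ᶠ b in nhds β, K * b ^ p < 1 / 16 := hcont.eventually_lt_const hgood
    have h2 : ∀ᶠ b in nhds β, K * b ^ p < K * β ^ p + τ / (2 * r) :=
      hcont.eventually_lt_const (lt_add_of_pos_right _ (by positivity))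
    obtain ⟨b, ⟨hb1, hb2⟩, hb⟩ :=
      (((h1.and h2).filter_mono nhdsWithin_le_nhds).and (self_mem_nhdsWithin (s := Ioi β))).exists
    have hb0 : 0 < b := hβ0.trans_lt hb
    obtain ⟨φ, hφ⟩ := exists_isCoordinate hp hcl (by linarith) hr hb
      (S := insert z ↑X ∩ closedBall z (20 * r))
      (fun x hx => ⟨hE x (by simpa using hx.1),
        closedBall_subset_closedBall (by nlinarith) hx.2⟩)
      (fun x hx y hy => hsep x (by simpa using hx.1) y (by simpa using hy.1))
    refine (h.insert_of_isCoordinate hz hq hzq hφ hr (by positivity)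
      (by rw [← hK]; nlinarith) hC).mono ?_
    rw [← hK]
    have h3 : K * b ^ p * r ≤ (K * β ^ p + τ / (2 * r)) * r := by gcongr
    have h4 : (K * β ^ p + τ / (2 * r)) * r = K * β ^ p * r + τ / 2 := by field_simp
    have h5 : 0 ≤ K * β ^ p * r := by positivity
    linarith
  · refine (h.insert_isolated hz hq).mono ?_
    have h3 : 1 / 16 * r ≤ K * β ^ p * r := by gcongr
    rw [dist_comm] at hzq
    linarith

end Flatness

section Construction

lemma sum_le_toReal_tsum_coe {α : Type*} {s : Set α} {f : α → ℝ} (hf : ∀ x, 0 ≤ f x)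
    (h : ∑' x : s, ENNReal.ofReal (f x) ≠ ⊤) {F : Finset α} (hF : ↑F ⊆ s) :
    ∑ x ∈ F, f x ≤ (∑' x : s, ENNReal.ofReal (f x)).toReal := by
  rw [← ENNReal.ofReal_le_iff_le_toReal h, ENNReal.ofReal_sum_of_nonneg fun x _ => hf x,
    tsum_subtype s fun x => ENNReal.ofReal (f x)]
  refine le_trans (Finset.sum_le_sum fun x hx => ?_) (ENNReal.sum_le_tsum F)
  rw [indicator_of_mem (hF hx)]

lemma Connectable.card_mul_le {V : Type*} [PseudoMetricSpace V] {X : Finset V} {T : ℝ} {C : V → ℝ}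
    {B s : ℝ} (h : Connectable X T C B) (hs : ∀ x ∈ X, ∀ y ∈ X, x ≠ y → s ≤ dist x y)
    (hC : ∀ x ∈ X, s / 2 ≤ C x) : X.card * s ≤ B := by
  obtain ⟨N, P, hN, -, -, hB⟩ := h
  have h1 : X.card * s ≤ ∑ x ∈ X, vertexCost N C x := by
    rw [← nsmul_eq_mul]
    refine Finset.card_nsmul_le_sum _ _ _ fun x hx => ?_
    unfold vertexCost
    have h2 : ((N x).card : ℝ) * s ≤ ∑ y ∈ N x, dist x y := by
      rw [← nsmul_eq_mul]
      refine Finset.card_nsmul_le_sum _ _ _ fun y hy => hs x hx y (hN.mem _ _ hy) ?_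
      rintro rfl
      exact hN.irrefl _ hy
    have h3 : ((N x).card : ℝ) ≤ 2 := by exact_mod_cast hN.card_le x
    have h4 : (2 - ((N x).card : ℝ)) * (s / 2) ≤ (2 - (N x).card) * C x :=
      mul_le_mul_of_nonneg_left (hC x hx) (by linarith)
    linarith
  have : 0 ≤ ∑ e ∈ P, dist e.1 e.2 := Finset.sum_nonneg fun _ _ => dist_nonneg
  linarith

/-- A finite set of pairs which connects the points of `X`. -/
def Connects {V : Type*} (P : Finset (V × V)) (X : Finset V) : Prop :=
  (∀ e ∈ P, e.1 ∈ X ∧ e.2 ∈ X) ∧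
    ∀ x ∈ X, ∀ y ∈ X, Relation.EqvGen (fun a b => (a, b) ∈ P) x y

lemma Connectable.exists_connects {V : Type*} [PseudoMetricSpace V] {X : Finset V} {T : ℝ}
    {C : V → ℝ} {B : ℝ} (h : Connectable X T C B) (hC : ∀ x ∈ X, 0 ≤ C x) :
    ∃ P : Finset (V × V), Connects P X ∧ ∑ e ∈ P, dist e.1 e.2 ≤ 8 * B := by
  obtain ⟨N, P, hN, hl, hP, hB⟩ := h
  set Q : Finset (V × V) := (X.sigma N).map (Equiv.sigmaEquivProd V V).toEmbedding with hQ
  have hmem : ∀ a b, b ∈ N a → (a, b) ∈ Q := by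
    intro a b hab
    rw [hQ, Finset.mem_map]
    exact ⟨⟨a, b⟩, Finset.mem_sigma.2 ⟨hN.mem _ _ (hN.symm _ _ hab), hab⟩, rfl⟩
  refine ⟨P ∪ Q, ⟨?_, ?_⟩, ?_⟩
  · intro e he
    rcases Finset.mem_union.1 he with he | he
    · exact hP e he
    · rw [hQ, Finset.mem_map] at he
      obtain ⟨⟨a, b⟩, hab, rfl⟩ := he
      rw [Finset.mem_sigma] at hab
      exact ⟨hab.1, hN.mem _ _ hab.2⟩
  · intro x hx y hy
    refine eqvGen_of_forall (fun a b hab => .rel _ _ ?_) (hl x hx y hy)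
    rcases hab with hab | hab
    · exact Finset.mem_union_right _ (hmem a b hab)
    · exact Finset.mem_union_left _ hab
  · have h1 : ∑ e ∈ Q, dist e.1 e.2 = ∑ x ∈ X, ∑ y ∈ N x, dist x y := by
      rw [hQ, Finset.sum_map, Finset.sum_sigma]
      rfl
    have h2 : ∑ e ∈ P ∪ Q, dist e.1 e.2 ≤ ∑ e ∈ P, dist e.1 e.2 + ∑ e ∈ Q, dist e.1 e.2 := by
      rw [← Finset.sum_union_inter]
      have : 0 ≤ ∑ e ∈ P ∩ Q, dist e.1 e.2 := Finset.sum_nonneg fun _ _ => dist_nonneg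
      linarith
    have h3 : ∑ x ∈ X, (∑ y ∈ N x, dist x y) / 2 ≤ ∑ x ∈ X, vertexCost N C x := by
      refine Finset.sum_le_sum fun x hx => ?_
      unfold vertexCost
      have h3 : ((N x).card : ℝ) ≤ 2 := by exact_mod_cast hN.card_le x
      have := mul_nonneg (sub_nonneg.2 h3) (hC x hx)
      linarith
    rw [← Finset.sum_div, ← h1] at h3
    have h4 : 0 ≤ ∑ e ∈ Q, dist e.1 e.2 := Finset.sum_nonneg fun _ _ => dist_nonneg
    linarith

variable {V : Type u} [NormedAddCommGroup V] [NormedSpace ℝ V]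

/-- The summand of `betaSum` belonging to the point `z` of generation `k`. -/
def betaTerm (E : Set V) (A p : ℝ) (k : ℤ) (z : V) : ℝ :=
  jonesBeta E (closedBall z (A * (2 : ℝ) ^ (-k))) ^ p *
    diam (closedBall z (A * (2 : ℝ) ^ (-k)))

lemma betaTerm_nonneg (E : Set V) (A p : ℝ) (k : ℤ) (z : V) : 0 ≤ betaTerm E A p k z :=
  mul_nonneg (Real.rpow_nonneg (jonesBeta_nonneg _ _) _) diam_nonneg

/-- The part of `betaSum` belonging to generation `k`. -/
def levelSum (E : Set V) (net : ℤ → Set V) (A p : ℝ) (k : ℤ) : ℝ≥0∞ :=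
  ∑' x : net k, ENNReal.ofReal (betaTerm E A p k x)

lemma two_zpow_neg_add_one (m : ℤ) : (2 : ℝ) ^ (-(m + 1)) = (2 : ℝ) ^ (-m) / 2 := by
  rw [neg_add, ← sub_eq_add_neg, zpow_sub_one₀ two_ne_zero, div_eq_mul_inv]

/-- The toll used while new points are added to `X`. -/
def stageToll (X : Set V) (r : ℝ) (x : V) : ℝ := 3 * r - infDist x X

section Stage

variable [Nontrivial V] {p A : ℝ} {E : Set V} {net : ℤ → Set V} {m : ℤ} {X : Finset V} {B : ℝ}

lemma Connectable.union_of_subset (hp : 1 < p) (hcl : HasClarkson V p) (hA : 240 ≤ A)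
    (hnet : IsMultiresolution E net) (hX : ↑X = net m) (hne : X.Nonempty)
    (h : ∀ τ > 0, Connectable X (8 * 2 ^ (-m)) (fun _ => 3 * 2 ^ (-m)) (B + τ))
    (F : Finset V) (hF : ↑F ⊆ net (m + 1)) (hFX : ∀ z ∈ F, z ∉ X) :
    ∀ τ > 0, Connectable (F ∪ X) (8 * 2 ^ (-m)) (stageToll X (2 ^ (-m)))
      (B + 112 * flatnessConst A p * ∑ z ∈ F, betaTerm E A p (m + 1) z + τ) := by
  obtain ⟨⟨hsub, hmono, hsep⟩, hcov⟩ := hnet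
  set r : ℝ := 2 ^ (-m) with hr
  have hr0 : 0 < r := by positivity
  have hr2 : (2 : ℝ) ^ (-(m + 1)) = r / 2 := two_zpow_neg_add_one m
  have hXsub : (X : Set V) ⊆ net (m + 1) := hX ▸ hmono m
  have hK : 0 ≤ flatnessConst A p := by
    unfold flatnessConst
    positivity
  induction F using Finset.induction_on with
  | empty =>
    intro τ hτ
    rw [Finset.empty_union, Finset.sum_empty, mul_zero, add_zero]
    refine (h τ hτ).mono_toll fun x _ => ?_
    have : 0 ≤ infDist x (X : Set V) := infDist_nonneg
    unfold stageToll
    linarith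
  | insert z F hzF ih =>
    intro τ hτ
    have hF' : ↑F ⊆ net (m + 1) := fun x hx => hF (by simp [Finset.mem_coe.1 hx])
    have hz : z ∈ net (m + 1) := hF (by simp)
    have ih' := ih hF' (fun x hx => hFX x (Finset.mem_insert_of_mem hx)) (τ / 2) (half_pos hτ)
    have hzX : z ∉ X := hFX z (Finset.mem_insert_self _ _)
    obtain ⟨q, hq, hdq⟩ := X.finite_toSet.isCompact.exists_infDist_eq_dist
      (Finset.coe_nonempty.2 hne) z
    have hzq : dist z q ≤ r := by
      obtain ⟨y, hy, hzy⟩ := hcov m z (hsub _ hz)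
      rw [← hdq]
      exact (infDist_le_dist_of_mem (hX ▸ hy)).trans hzy
    have hall : ∀ x ∈ insert z (F ∪ X), x ∈ net (m + 1) := by
      intro x hx
      rcases Finset.mem_insert.1 hx with rfl | hx
      · exact hz
      · rcases Finset.mem_union.1 hx with hx | hx
        · exact hF' hx
        · exact hXsub hx
    have hstep := Connectable.insert_of_jonesBeta hp hcl (E := E) hA hr0 ih' (z := z) (q := q)
      (by simp [hzF, hzX]) (Finset.mem_union_right _ hq) hzq
      (fun x hx => hsub _ (hall x hx))
      (fun x hx y hy hxy => by
        have := hsep (m + 1) x (hall x hx) y (hall y hy) hxy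
        rwa [hr2] at this)
      (by
        have : 0 ≤ infDist z (X : Set V) := infDist_nonneg
        unfold stageToll
        linarith)
      (fun x => by
        have := infDist_le_dist_of_mem (x := x) hq
        unfold stageToll
        linarith) (half_pos hτ)
    rw [Finset.insert_union, Finset.sum_insert hzF]
    refine hstep.mono ?_
    have hterm : jonesBeta E (closedBall z (A * (r / 2))) ^ p * r ≤ betaTerm E A p (m + 1) z := by
      unfold betaTerm
      rw [hr2, diam_closedBall_eq z (by positivity)]
      have := Real.rpow_nonneg (jonesBeta_nonneg E (closedBall z (A * (r / 2)))) p
      gcongr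
      nlinarith
    have := mul_le_mul_of_nonneg_left hterm (mul_nonneg (by norm_num : (0 : ℝ) ≤ 112) hK)
    linarith

lemma exists_finset_of_stage (hp : 1 < p) (hcl : HasClarkson V p) (hA : 240 ≤ A)
    (hnet : IsMultiresolution E net) (hX : ↑X = net m) (hne : X.Nonempty)
    (hfin : levelSum E net A p (m + 1) ≠ ⊤)
    (h : ∀ τ > 0, Connectable X (8 * 2 ^ (-m)) (fun _ => 3 * 2 ^ (-m)) (B + τ)) :
    ∃ Y : Finset V, ↑Y = net (m + 1) ∧ ∀ τ > 0,
      Connectable Y (8 * 2 ^ (-(m + 1))) (fun _ => 3 * 2 ^ (-(m + 1)))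
        (B + 112 * flatnessConst A p * (levelSum E net A p (m + 1)).toReal + τ) := by
  have hstage := Connectable.union_of_subset hp hcl hA hnet hX hne h
  obtain ⟨⟨hsub, hmono, hsep⟩, hcov⟩ := hnet
  set r : ℝ := 2 ^ (-m) with hr
  have hr0 : 0 < r := by positivity
  have hr2 : (2 : ℝ) ^ (-(m + 1)) = r / 2 := two_zpow_neg_add_one m
  have hXsub : (X : Set V) ⊆ net (m + 1) := hX ▸ hmono m
  have hK : 0 ≤ flatnessConst A p := by
    unfold flatnessConst
    positivity
  have htoll : ∀ x ∈ net (m + 1), 2 * r ≤ stageToll X r x := by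
    intro x hx
    obtain ⟨y, hy, hxy⟩ := hcov m x (hsub _ hx)
    have := (infDist_le_dist_of_mem (hX ▸ hy : y ∈ (X : Set V))).trans hxy
    unfold stageToll
    linarith
  have hcost : ∀ F : Finset V, ↑F ⊆ net (m + 1) → (∀ z ∈ F, z ∉ X) → ∀ τ > 0,
      Connectable (F ∪ X) (8 * r) (stageToll X r)
        (B + 112 * flatnessConst A p * (levelSum E net A p (m + 1)).toReal + τ) := by
    intro F hF hFX τ hτ
    refine (hstage F hF hFX τ hτ).mono ?_
    have := sum_le_toReal_tsum_coe (betaTerm_nonneg E A p (m + 1)) hfin hF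
    unfold levelSum
    gcongr
  have hfinite : (net (m + 1) \ net m).Finite := by
    by_contra hinf
    set M := B + 112 * flatnessConst A p * (levelSum E net A p (m + 1)).toReal + 1
    obtain ⟨n, hn⟩ := exists_nat_gt (M / (r / 2))
    obtain ⟨F, hF, hFn⟩ := Set.Infinite.exists_subset_card_eq hinf n
    have hF1 : ↑F ⊆ net (m + 1) := fun x hx => (hF hx).1
    have hall : ∀ x ∈ F ∪ X, x ∈ net (m + 1) := by
      intro x hx
      rcases Finset.mem_union.1 hx with hx | hx
      · exact hF1 hx
      · exact hXsub hx
    have h1 := (hcost F hF1 (fun z hz hzX => (hF hz).2 (hX ▸ hzX)) 1 one_pos).card_mul_le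
      (s := r / 2)
      (fun x hx y hy hxy => hr2 ▸ hsep (m + 1) x (hall x hx) y (hall y hy) hxy)
      (fun x hx => by have := htoll x (hall x hx); linarith)
    have h2 : (n : ℝ) ≤ (F ∪ X).card := by
      rw [← hFn]
      exact_mod_cast Finset.card_le_card Finset.subset_union_left
    rw [div_lt_iff₀ (by positivity)] at hn
    have h3 : (n : ℝ) * (r / 2) ≤ (F ∪ X).card * (r / 2) := by gcongr
    linarith
  have hunion : ((hfinite.toFinset ∪ X : Finset V) : Set V) = net (m + 1) := by
    rw [Finset.coe_union, Finite.coe_toFinset, hX, sdiff_union_self]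
    exact union_eq_self_of_subset_right (hmono m)
  refine ⟨hfinite.toFinset ∪ X, hunion, fun τ hτ => ?_⟩
  have hmain := hcost hfinite.toFinset (by simp) (fun z hz hzX => by
    rw [Finite.mem_toFinset] at hz
    exact hz.2 (hX ▸ hzX)) τ hτ
  have h3 := hmain.mono_toll (C' := fun _ => 3 * (r / 2)) (fun x hx => by
    have := htoll x (hunion ▸ hx)
    linarith)
  rw [hr2]
  exact h3.prune (by linarith)

end Stage

lemma exists_connects_net [Nontrivial V] {p A : ℝ} {E : Set V} {net : ℤ → Set V} (hp : 1 < p)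
    (hcl : HasClarkson V p) (hA : 240 ≤ A) (hE : E.Nonempty) (hb : IsBounded E)
    (hnet : IsMultiresolution E net) (hsum : betaSum E net A p < ⊤) :
    ∃ (m : ℤ) (M : ℝ), ∀ n : ℕ, ∃ (X : Finset V) (P : Finset (V × V)), ↑X = net (m + n) ∧
      Connects P X ∧ ∑ e ∈ P, dist e.1 e.2 ≤ M := by
  have hbeta : betaSum E net A p = ∑' k, levelSum E net A p k := rfl
  have hK : 0 ≤ flatnessConst A p := by
    unfold flatnessConst
    positivity
  have hlevel : ∀ k, levelSum E net A p k ≠ ⊤ :=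
    fun k => ((ENNReal.le_tsum k).trans_lt (hbeta ▸ hsum)).ne
  obtain ⟨j, hj⟩ := pow_unbounded_of_one_lt (diam E) (one_lt_two (α := ℝ))
  set m : ℤ := -j with hm
  have hmj : diam E < 2 ^ (-m) := by rwa [hm, neg_neg, zpow_natCast]
  obtain ⟨e, he⟩ := hE
  obtain ⟨x₀, hx₀, -⟩ := hnet.2 m e he
  have hsingle : net m = {x₀} := by
    refine (subset_singleton_iff.2 fun y hy => ?_).antisymm (singleton_subset_iff.2 hx₀)
    by_contra hne
    have h1 := hnet.1.2.2 m y hy x₀ hx₀ hne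
    have h2 := dist_le_diam_of_mem hb (hnet.1.1 m hy) (hnet.1.1 m hx₀)
    linarith
  have hind : ∀ n : ℕ, ∃ X : Finset V, X.Nonempty ∧ ↑X = net (m + n) ∧ ∀ τ > 0,
      Connectable X (8 * 2 ^ (-(m + n))) (fun _ => 3 * 2 ^ (-(m + n)))
        (6 * 2 ^ (-m) + 112 * flatnessConst A p *
          ∑ i ∈ Finset.range n, (levelSum E net A p (m + i + 1)).toReal + τ) := by
    intro n
    induction n with
    | zero =>
      refine ⟨{x₀}, Finset.singleton_nonempty _, by simp [hsingle], fun τ hτ => ?_⟩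
      refine ⟨fun _ => ∅, ∅, ⟨by simp, by simp, by simp, by simp, by simp, by simp⟩, ?_,
        by simp, ?_⟩
      · intro x hx y hy
        rw [Finset.mem_singleton] at hx hy
        rw [hx, hy]
        exact .refl _
      · simp [vertexCost]
        linarith
    | succ n ih =>
      obtain ⟨X, hne, hX, hconn⟩ := ih
      obtain ⟨Y, hY, hconn'⟩ := exists_finset_of_stage hp hcl hA hnet hX hne (hlevel _) hconn
      refine ⟨Y, ?_, ?_, fun τ hτ => ?_⟩
      · rw [← Finset.coe_nonempty, hY]
        exact (Finset.coe_nonempty.2 hne).mono (hX ▸ hnet.1.2.1 _)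
      · rw [hY]
        push_cast
        rw [add_assoc]
      · have := hconn' τ hτ
        push_cast
        rw [← add_assoc]
        refine this.mono ?_
        rw [Finset.sum_range_succ]
        linarith
  refine ⟨m, 8 * (6 * 2 ^ (-m) + 112 * flatnessConst A p * (betaSum E net A p).toReal + 1),
    fun n => ?_⟩
  obtain ⟨X, -, hX, hconn⟩ := hind n
  obtain ⟨P, hP, hPB⟩ := (hconn 1 one_pos).exists_connects fun _ _ => by positivity
  refine ⟨X, P, hX, hP, hPB.trans ?_⟩
  have : ∑ i ∈ Finset.range n, (levelSum E net A p (m + i + 1)).toReal ≤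
      (betaSum E net A p).toReal := by
    rw [← ENNReal.toReal_sum fun i _ => hlevel _]
    refine ENNReal.toReal_mono hsum.ne ?_
    rw [hbeta]
    have hinj : Function.Injective fun i : ℕ => m + i + 1 := by
      intro a b hab
      simpa using hab
    exact (ENNReal.sum_le_tsum _).trans (ENNReal.tsum_comp_le_tsum_of_injective hinj _)
  gcongr

end Construction

section Tour

variable {V : Type*} [NormedAddCommGroup V] [NormedSpace ℝ V]

lemma detour_estimate {d t : ℝ} (hd : 0 ≤ d) (x y : ℝ) :
    |(min x t + max (x - t - 2 * d) 0) - (min y t + max (y - t - 2 * d) 0)| +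
      |max (d - |x - t - d|) 0 - max (d - |y - t - d|) 0| ≤ |x - y| := by
  wlog hxy : x ≤ y generalizing x y
  · have := this y x (le_of_not_ge hxy)
    rwa [abs_sub_comm (min x t + _), abs_sub_comm (max (d - |x - t - d|) 0), abs_sub_comm x]
  have key : ∀ s : ℝ, (s ≤ t ∧ min s t + max (s - t - 2 * d) 0 = s ∧ max (d - |s - t - d|) 0 = 0) ∨
      (t ≤ s ∧ s ≤ t + d ∧ min s t + max (s - t - 2 * d) 0 = t ∧
        max (d - |s - t - d|) 0 = s - t) ∨
      (t + d ≤ s ∧ s ≤ t + 2 * d ∧ min s t + max (s - t - 2 * d) 0 = t ∧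
        max (d - |s - t - d|) 0 = t + 2 * d - s) ∨
      (t + 2 * d ≤ s ∧ min s t + max (s - t - 2 * d) 0 = s - 2 * d ∧
        max (d - |s - t - d|) 0 = 0) := by
    intro s
    rcases le_total s t with h1 | h1
    · refine .inl ⟨h1, ?_, ?_⟩
      · rw [min_eq_left h1, max_eq_right (by linarith), add_zero]
      · rw [abs_of_nonpos (by linarith), max_eq_right (by linarith)]
    rcases le_total s (t + d) with h2 | h2
    · refine .inr (.inl ⟨h1, h2, ?_, ?_⟩)
      · rw [min_eq_right h1, max_eq_right (by linarith), add_zero]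
      · rw [abs_of_nonpos (by linarith), max_eq_left (by linarith)]
        ring
    rcases le_total s (t + 2 * d) with h3 | h3
    · refine .inr (.inr (.inl ⟨h2, h3, ?_, ?_⟩))
      · rw [min_eq_right h1, max_eq_right (by linarith), add_zero]
      · rw [abs_of_nonneg (by linarith), max_eq_left (by linarith)]
        ring
    · refine .inr (.inr (.inr ⟨h3, ?_, ?_⟩))
      · rw [min_eq_right h1, max_eq_left (by linarith)]
        ring
      · rw [abs_of_nonneg (by linarith), max_eq_right (by linarith)]
  have habs : ∀ a b c : ℝ, a + b ≤ c → a - b ≤ c → -a + b ≤ c → -a - b ≤ c → |a| + |b| ≤ c := by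
    intro a b c h1 h2 h3 h4
    cases abs_cases a <;> cases abs_cases b <;> linarith
  rw [abs_of_nonpos (sub_nonpos.2 hxy)]
  rcases key x with ⟨h1, h2, h3⟩ | ⟨h0, h1, h2, h3⟩ | ⟨h0, h1, h2, h3⟩ | ⟨h1, h2, h3⟩ <;>
  rcases key y with ⟨k1, k2, k3⟩ | ⟨k0, k1, k2, k3⟩ | ⟨k0, k1, k2, k3⟩ | ⟨k1, k2, k3⟩ <;>
  rw [h2, h3, k2, k3] <;>
  refine habs _ _ _ ?_ ?_ ?_ ?_ <;>
  linarith

lemma detour_mem {K : Set V} (hK : Convex ℝ K) {u v : V} (hu : u ∈ K) (hv : v ∈ K) {d h : ℝ}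
    (hd : 0 < d) (h0 : 0 ≤ h) (hle : h ≤ d) : u + (h / d) • (v - u) ∈ K :=
  hK.add_smul_sub_mem hu hv ⟨by positivity, (div_le_one hd).2 hle⟩

/-- A curve of length `L` through the points of `S` can be extended by a detour to a further
point. -/
lemma exists_lipschitzWith_insert {K S : Set V} (hK : Convex ℝ K) {u v : V} (hu : u ∈ S)
    (hv : v ∈ K) {f : ℝ → V} {L : ℝ} (hf : LipschitzWith 1 f) (hfK : ∀ s, f s ∈ K)
    (hS : S ⊆ f '' Icc 0 L) :
    ∃ g : ℝ → V, LipschitzWith 1 g ∧ (∀ s, g s ∈ K) ∧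
      insert v S ⊆ g '' Icc 0 (L + 2 * dist u v) := by
  obtain ⟨t, ht, rfl⟩ := hS hu
  rcases eq_or_ne (f t) v with rfl | huv
  · refine ⟨f, hf, hfK, ?_⟩
    rw [dist_self, mul_zero, add_zero, insert_eq_of_mem hu]
    exact hS
  set d := dist (f t) v with hd
  have hd0 : 0 < d := dist_pos.2 huv
  set σ : ℝ → ℝ := fun s => min s t + max (s - t - 2 * d) 0 with hσ
  set h : ℝ → ℝ := fun s => max (d - |s - t - d|) 0 with hh
  have hσ1 : ∀ s ≤ t, σ s = s := fun s hs => by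
    rw [hσ]
    dsimp only
    rw [min_eq_left hs, max_eq_right (by linarith), add_zero]
  have hσ2 : ∀ s, t ≤ s → s ≤ t + 2 * d → σ s = t := fun s hs hs' => by
    rw [hσ]
    dsimp only
    rw [min_eq_right hs, max_eq_right (by linarith), add_zero]
  have hσ3 : ∀ s, t + 2 * d ≤ s → σ s = s - 2 * d := fun s hs => by
    rw [hσ]
    dsimp only
    rw [min_eq_right (by linarith), max_eq_left (by linarith)]
    ring
  have hh1 : ∀ s ≤ t, h s = 0 := fun s hs => max_eq_right (by
    rw [abs_of_nonpos (by linarith)]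
    linarith)
  have hh3 : ∀ s, t + 2 * d ≤ s → h s = 0 := fun s hs => max_eq_right (by
    rw [abs_of_nonneg (by linarith)]
    linarith)
  refine ⟨fun s => f (σ s) + (h s / d) • (v - f t), ?_, fun s => ?_, ?_⟩
  · refine LipschitzWith.of_dist_le_mul fun x y => ?_
    rw [NNReal.coe_one, one_mul, Real.dist_eq]
    refine le_trans ?_ (detour_estimate (t := t) hd0.le x y)
    refine (dist_add_add_le _ _ _ _).trans (add_le_add ?_ (le_of_eq ?_))
    · have := hf.dist_le_mul (σ x) (σ y)
      rwa [NNReal.coe_one, one_mul, Real.dist_eq] at this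
    · rw [dist_eq_norm, ← sub_smul, ← sub_div, norm_smul, norm_div, ← dist_eq_norm v, dist_comm v,
        Real.norm_eq_abs, Real.norm_of_nonneg hd0.le, ← hd, div_mul_cancel₀ _ hd0.ne']
  · by_cases hs : t ≤ s ∧ s ≤ t + 2 * d
    · dsimp only
      rw [hσ2 s hs.1 hs.2]
      exact detour_mem hK (hfK t) hv hd0 (le_max_right _ _)
        (max_le (by linarith [abs_nonneg (s - t - d)]) hd0.le)
    · have : h s = 0 := by
        rcases le_total s t with h1 | h1
        · exact hh1 s h1
        · exact hh3 s (le_of_not_ge fun h2 => hs ⟨h1, h2⟩)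
      dsimp only
      rw [this, zero_div, zero_smul, add_zero]
      exact hfK _
  · rintro x (rfl | hx)
    · refine ⟨t + d, ⟨by linarith [ht.1], by linarith [ht.2]⟩, ?_⟩
      have h1 : h (t + d) = d := by
        rw [hh]
        dsimp only
        rw [show t + d - t - d = 0 by ring, abs_zero, sub_zero, max_eq_left hd0.le]
      dsimp only
      rw [hσ2 _ (by linarith) (by linarith), h1, div_self hd0.ne', one_smul, add_sub_cancel]
    · obtain ⟨s, hs, rfl⟩ := hS hx
      rcases le_total s t with h1 | h1
      · refine ⟨s, ⟨hs.1, by linarith [hs.2]⟩, ?_⟩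
        dsimp only
        rw [hσ1 s h1, hh1 s h1, zero_div, zero_smul, add_zero]
      · refine ⟨s + 2 * d, ⟨by linarith [hs.1], by linarith [hs.2]⟩, ?_⟩
        dsimp only
        rw [hσ3 _ (by linarith), hh3 _ (by linarith), zero_div, zero_smul, add_zero,
          add_sub_cancel_right]

lemma Connects.subset_of_closed {α : Type*} {P : Finset (α × α)} {X S : Finset α}
    (h : Connects P X) (hS : S.Nonempty) (hSX : S ⊆ X)
    (hP : ∀ e ∈ P, e.1 ∈ S ↔ e.2 ∈ S) : X ⊆ S := by
  obtain ⟨a, ha⟩ := hS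
  intro b hb
  have key : ∀ x y, Relation.EqvGen (fun a b => (a, b) ∈ P) x y → (x ∈ S ↔ y ∈ S) := by
    intro x y hxy
    induction hxy with
    | rel x y hxy => exact hP _ hxy
    | refl x => exact Iff.rfl
    | symm x y _ ih => exact ih.symm
    | trans x y z _ _ ih ih' => exact ih.trans ih'
  exact (key _ _ (h.2 a (hSX ha) b hb)).1 ha

lemma Connects.exists_lipschitzWith {P : Finset (V × V)} {X : Finset V} (h : Connects P X)
    (hX : X.Nonempty) {K : Set V} (hK : Convex ℝ K) (hXK : ↑X ⊆ K) :
    ∃ f : ℝ → V, LipschitzWith 1 f ∧ (∀ s, f s ∈ K) ∧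
      ↑X ⊆ f '' Icc 0 (2 * ∑ e ∈ P, dist e.1 e.2) := by
  let good : Finset V → Prop := fun S => S.Nonempty ∧ ∃ Q ⊆ P, (∀ e ∈ Q, e.1 ∈ S ∧ e.2 ∈ S) ∧
    ∃ f : ℝ → V, LipschitzWith 1 f ∧ (∀ s, f s ∈ K) ∧
      ↑S ⊆ f '' Icc 0 (2 * ∑ e ∈ Q, dist e.1 e.2)
  obtain ⟨x₀, hx₀⟩ := hX
  have hstart : good {x₀} := by
    refine ⟨Finset.singleton_nonempty _, ∅, by simp, by simp, fun _ => x₀,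
      LipschitzWith.const' _, fun _ => hXK hx₀, ?_⟩
    simp
  obtain ⟨S, hS, hmax⟩ := Finset.exists_max_image (X.powerset.filter good) Finset.card
    ⟨{x₀}, by simp [hx₀, hstart]⟩
  rw [Finset.mem_filter, Finset.mem_powerset] at hS
  obtain ⟨hSX, hSne, Q, hQP, hQS, f, hf, hfK, hSf⟩ := hS
  have hclosed : ∀ e ∈ P, e.1 ∈ S ↔ e.2 ∈ S := by
    have key : ∀ e ∈ P, ∀ u v, dist u v = dist e.1 e.2 → u ∈ S → v ∉ S → v ∈ X →
        (e.1 = u ∧ e.2 = v ∨ e.1 = v ∧ e.2 = u) → False := by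
      intro e he u v hd hu hv hvX heq
      have heQ : e ∉ Q := by
        intro heQ
        obtain ⟨h1, h2⟩ := hQS e heQ
        rcases heq with ⟨-, h3⟩ | ⟨h3, -⟩
        · exact hv (h3 ▸ h2)
        · exact hv (h3 ▸ h1)
      obtain ⟨g, hg, hgK, hSg⟩ := exists_lipschitzWith_insert hK (Finset.mem_coe.2 hu) (hXK hvX)
        hf hfK hSf
      have hgood : good (insert v S) := by
        refine ⟨Finset.insert_nonempty _ _, insert e Q, Finset.insert_subset he hQP, ?_,
          g, hg, hgK, ?_⟩
        · intro e' he'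
          rcases Finset.mem_insert.1 he' with rfl | he'
          · rcases heq with ⟨h1, h2⟩ | ⟨h1, h2⟩ <;> simp [h1, h2, hu]
          · exact (hQS e' he').imp Finset.mem_insert_of_mem Finset.mem_insert_of_mem
        · rw [Finset.sum_insert heQ, Finset.coe_insert, add_comm, mul_add, ← hd]
          exact hSg
      have := hmax (insert v S) (Finset.mem_filter.2 ⟨Finset.mem_powerset.2
        (Finset.insert_subset hvX hSX), hgood⟩)
      rw [Finset.card_insert_of_notMem hv] at this
      omega
    intro e he
    constructor
    · intro h1
      by_contra h2
      exact key e he _ _ rfl h1 h2 (h.1 e he).2 (.inl ⟨rfl, rfl⟩)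
    · intro h1
      by_contra h2
      exact key e he _ _ (dist_comm _ _) h1 h2 (h.1 e he).1 (.inr ⟨rfl, rfl⟩)
  have hXS := h.subset_of_closed hSne hSX hclosed
  refine ⟨f, hf, hfK, (Finset.coe_subset.2 hXS).trans (hSf.trans (image_mono ?_))⟩
  refine Icc_subset_Icc le_rfl ?_
  gcongr

/-- Curves of bounded length in a common compact set subconverge to a curve. -/
lemma exists_lipschitzWith_of_forall_nat {V : Type*} [MetricSpace V] {K : Set V}
    (hK : IsCompact K) {L : ℝ} {X : ℕ → Set V}
    (hX : Monotone X)
    (h : ∀ n, ∃ f : ℝ → V, LipschitzWith 1 f ∧ (∀ s, f s ∈ K) ∧ X n ⊆ f '' Icc 0 L) :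
    ∃ f : ℝ → V, LipschitzWith 1 f ∧ ⋃ n, X n ⊆ f '' Icc 0 L := by
  choose f hf hfK hfX using h
  let U : Ultrafilter ℕ := Filter.hyperfilter ℕ
  have hlim : ∀ s, ∃ y, Filter.Tendsto (fun n => f n s) U (nhds y) := by
    intro s
    obtain ⟨y, -, hy⟩ := hK.ultrafilter_le_nhds (U.map fun n => f n s) (by
      rw [Filter.le_principal_iff, Ultrafilter.coe_map]
      exact Filter.mem_map.2 (Filter.univ_mem' fun n => hfK n s))
    exact ⟨y, hy⟩
  choose g hg using hlim
  have hdist : ∀ n x y, dist (f n x) (f n y) ≤ dist x y := by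
    intro n x y
    have := (hf n).dist_le_mul x y
    rwa [NNReal.coe_one, one_mul] at this
  refine ⟨g, LipschitzWith.of_dist_le_mul fun x y => ?_, ?_⟩
  · rw [NNReal.coe_one, one_mul]
    exact le_of_tendsto ((hg x).dist (hg y)) (Filter.Eventually.of_forall fun n => hdist n x y)
  · intro x hx
    obtain ⟨k, hk⟩ := mem_iUnion.1 hx
    have hL : 0 ≤ L := by
      obtain ⟨t, ht, -⟩ := hfX k hk
      exact ht.1.trans ht.2
    have : ∀ n, ∃ t ∈ Icc 0 L, k ≤ n → f n t = x := by
      intro n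
      by_cases hkn : k ≤ n
      · obtain ⟨t, ht, htx⟩ := hfX n (hX hkn hk)
        exact ⟨t, ht, fun _ => htx⟩
      · exact ⟨0, ⟨le_rfl, hL⟩, fun h => absurd h hkn⟩
    choose t ht htx using this
    obtain ⟨s, hs, hts⟩ := isCompact_Icc.ultrafilter_le_nhds (U.map t) (by
      rw [Filter.le_principal_iff, Ultrafilter.coe_map]
      exact Filter.mem_map.2 (Filter.univ_mem' ht))
    refine ⟨s, hs, ?_⟩
    have hts' : Filter.Tendsto t U (nhds s) := hts
    have h1 : Filter.Tendsto (fun n => dist s (t n)) U (nhds 0) := by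
      have := (tendsto_const_nhds (x := s)).dist hts'
      rwa [dist_self] at this
    have hev : ∀ᶠ n in (U : Filter ℕ), k ≤ n := by
      have : ∀ᶠ n in Filter.cofinite, k ≤ n := by
        rw [Nat.cofinite_eq_atTop]
        exact Filter.eventually_ge_atTop k
      exact Filter.hyperfilter_le_cofinite this
    have h2 : dist (g s) x ≤ 0 := by
      refine le_of_tendsto_of_tendsto ((hg s).dist tendsto_const_nhds) h1 ?_
      filter_upwards [hev] with n hn
      rw [← htx n hn]
      exact hdist n _ _
    exact dist_le_zero.1 h2

lemma isRectifiableCurve_image {V : Type u} [NormedAddCommGroup V] [NormedSpace ℝ V]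
    [MeasurableSpace V] [BorelSpace V] {f : ℝ → V}
    (hf : LipschitzWith 1 f) {L : ℝ} (hL : 0 ≤ L) : IsRectifiableCurve (f '' Icc 0 L) := by
  refine ⟨⟨fun s => f (L * s), (hf.continuous.comp (by fun_prop)).continuousOn, ?_⟩, ?_⟩
  · have : Icc 0 L = (fun s => L * s) '' Icc (0 : ℝ) 1 := by
      rw [image_mul_left_Icc hL zero_le_one, mul_zero, mul_one]
    rw [this, image_image]
  · refine (hf.hausdorffMeasure_image_le zero_le_one _).trans_lt ?_
    rw [hausdorffMeasure_real]
    simp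

lemma exists_isRectifiableCurve {V : Type u} [NormedAddCommGroup V] [NormedSpace ℝ V]
    [CompleteSpace V] [Nontrivial V] [MeasurableSpace V] [BorelSpace V] {p A : ℝ} {E : Set V}
    {net : ℤ → Set V} (hp : 1 < p)
    (hcl : HasClarkson V p) (hA : 240 ≤ A) (hE : E.Nonempty) (hb : IsBounded E)
    (hnet : IsMultiresolution E net) (hsum : betaSum E net A p < ⊤) :
    ∃ Γ : Set V, E ⊆ Γ ∧ IsRectifiableCurve Γ := by
  obtain ⟨m, M, hM⟩ := exists_connects_net hp hcl hA hE hb hnet hsum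
  have happrox : ∀ ε > 0, ∃ n : ℕ, ∀ e ∈ E, ∃ x ∈ net (m + n), dist e x < ε := by
    intro ε hε
    have h1 : Filter.Tendsto (fun n : ℕ => (2 : ℝ) ^ (-m) * (1 / 2) ^ n) Filter.atTop (nhds 0) := by
      have := (tendsto_pow_atTop_nhds_zero_of_lt_one (r := (1 / 2 : ℝ)) (by norm_num)
        (by norm_num)).const_mul ((2 : ℝ) ^ (-m))
      rwa [mul_zero] at this
    obtain ⟨n, hn⟩ := (h1.eventually_lt_const hε).exists
    refine ⟨n, fun e he => ?_⟩
    obtain ⟨x, hx, hex⟩ := hnet.2 (m + n) e he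
    refine ⟨x, hx, hex.trans_lt ?_⟩
    rwa [neg_add, zpow_add₀ two_ne_zero, zpow_neg _ (n : ℤ), zpow_natCast, ← inv_pow,
      ← one_div]
  have hmono : Monotone fun n : ℕ => net (m + n) := by
    refine monotone_nat_of_le_succ fun n => ?_
    have := hnet.1.2.1 (m + n)
    rwa [add_assoc] at this
  have htb : TotallyBounded E := by
    rw [totallyBounded_iff]
    intro ε hε
    obtain ⟨n, hn⟩ := happrox ε hε
    obtain ⟨X, P, hX, -⟩ := hM n
    refine ⟨net (m + n), hX ▸ X.finite_toSet, fun e he => ?_⟩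
    obtain ⟨x, hx, hex⟩ := hn e he
    exact mem_iUnion₂.2 ⟨x, hx, hex⟩
  set K := closure (convexHull ℝ E) with hKdef
  have hK : IsCompact K := htb.convexHull.closure.isCompact_of_isClosed isClosed_closure
  have hKconv : Convex ℝ K := (convex_convexHull ℝ E).closure
  have hEK : E ⊆ K := (subset_convexHull ℝ E).trans subset_closure
  have hM0 : 0 ≤ M := by
    obtain ⟨X, P, -, -, hPM⟩ := hM 0
    exact (Finset.sum_nonneg fun _ _ => dist_nonneg).trans hPM
  obtain ⟨f, hf, hcover⟩ := exists_lipschitzWith_of_forall_nat hK (L := 2 * M) hmono (fun n => by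
    obtain ⟨X, P, hX, hP, hPM⟩ := hM n
    have hXne : X.Nonempty := by
      obtain ⟨e, he⟩ := hE
      obtain ⟨x, hx, -⟩ := hnet.2 (m + n) e he
      exact ⟨x, Finset.mem_coe.1 (hX ▸ hx)⟩
    obtain ⟨f, hf, hfK, hXf⟩ := hP.exists_lipschitzWith hXne hKconv
      (hX ▸ (hnet.1.1 _).trans hEK)
    refine ⟨f, hf, hfK, ?_⟩
    rw [← hX]
    exact hXf.trans (image_mono (Icc_subset_Icc le_rfl (by linarith))))
  refine ⟨f '' Icc 0 (2 * M), ?_, isRectifiableCurve_image hf (by positivity)⟩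
  have hclosed : IsClosed (f '' Icc 0 (2 * M)) := (isCompact_Icc.image hf.continuous).isClosed
  refine fun e he => hclosed.closure_subset (Metric.mem_closure_iff.2 fun ε hε => ?_)
  obtain ⟨n, hn⟩ := happrox ε hε
  obtain ⟨x, hx, hex⟩ := hn e he
  exact ⟨x, hcover (mem_iUnion.2 ⟨n, hx⟩), hex⟩

end Tour

lemma abs_add_rpow_add_abs_sub_rpow_le {p : ℝ} (hp0 : 0 < p) (hp : p ≤ 2) (a b : ℝ) :
    |a + b| ^ p + |a - b| ^ p ≤ 2 * (|a| ^ p + |b| ^ p) := by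
  have hsq : ∀ c : ℝ, |c| ^ p = (c ^ 2) ^ (p / 2) := by
    intro c
    rw [← sq_abs, ← Real.rpow_natCast, ← Real.rpow_mul (abs_nonneg _)]
    congr 1
    push_cast
    ring
  rw [hsq, hsq, hsq, hsq]
  have hq0 : 0 ≤ p / 2 := by linarith
  have hq1 : p / 2 ≤ 1 := by linarith
  have hconc := (Real.concaveOn_rpow hq0 hq1).2 (mem_Ici.2 (sq_nonneg (a + b)))
    (mem_Ici.2 (sq_nonneg (a - b))) (by norm_num : (0 : ℝ) ≤ 1 / 2)
    (by norm_num : (0 : ℝ) ≤ 1 / 2) (by norm_num)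
  simp only [smul_eq_mul] at hconc
  rw [show 1 / 2 * (a + b) ^ 2 + 1 / 2 * (a - b) ^ 2 = a ^ 2 + b ^ 2 by ring] at hconc
  have hsub := Real.rpow_add_le_add_rpow (sq_nonneg a) (sq_nonneg b) hq0 hq1
  linarith

lemma hasClarkson_ellp {p : ℝ} [Fact (1 ≤ ENNReal.ofReal p)] (hp1 : 1 < p) (hp2 : p ≤ 2) :
    HasClarkson (ellp p) p := by
  have hp : 0 < (ENNReal.ofReal p).toReal := by
    rw [ENNReal.toReal_ofReal (by linarith)]
    linarith
  have hsum : ∀ x : ellp p, HasSum (fun i => |x i| ^ p) (‖x‖ ^ p) := by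
    intro x
    have := lp.hasSum_norm hp x
    rwa [ENNReal.toReal_ofReal (by linarith)] at this
  intro x y
  refine hasSum_le (fun i => ?_) ((hsum (x + y)).add (hsum (x - y)))
    (((hsum x).add (hsum y)).mul_left 2)
  exact abs_add_rpow_add_abs_sub_rpow_le (by linarith) hp2 (x i) (y i)

lemma nontrivial_ellp (p : ℝ) [Fact (1 ≤ ENNReal.ofReal p)] : Nontrivial (ellp p) := by
  refine ⟨lp.single (ENNReal.ofReal p) 0 (1 : ℝ), 0, fun h => ?_⟩
  have := congrArg (fun x : ellp p => x 0) h
  simp at this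

/-- Sufficient condition in `ℓ_p`, `1 < p ≤ 2`: if `Σ_{Q ∈ G} β_E(Q)^p diam Q < ∞`
for a multiresolution family with inflation factor `A ≥ 240`, then the bounded set
`E` lies in a rectifiable curve. -/
theorem statement18 (p A : ℝ) (hp1 : 1 < p) (hp2 : p ≤ 2) (hA : 240 ≤ A) :
    letI : Fact (1 ≤ ENNReal.ofReal p) := ⟨ENNReal.one_le_ofReal.mpr (le_of_lt hp1)⟩
    ∀ [MeasurableSpace (ellp p)] [BorelSpace (ellp p)],
      ∀ (E : Set (ellp p)) (net : ℤ → Set (ellp p)),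
        E.Nonempty → IsBounded E → IsMultiresolution E net → betaSum E net A p < ⊤ →
        ∃ Γ : Set (ellp p), E ⊆ Γ ∧ IsRectifiableCurve Γ := by
  intro _ _ E net hE hb hnet hsum
  have : Fact (1 ≤ ENNReal.ofReal p) := ⟨ENNReal.one_le_ofReal.mpr hp1.le⟩
  have := nontrivial_ellp p
  exact exists_isRectifiableCurve hp1 (hasClarkson_ellp hp1 hp2) hA hE hb hnet hsum

end
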